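/- Fix ε ∈ (0, 1/α) and set c₁ = C(d,α)/5. There exists T > 0 such that for all t ≥ T and all x, y ∈ ℝ^d with 1 ≤ |x − y| < t^{1/α−ε}, ∫_{ℝ^d} ( 1 − exp( −(t/2)( v̂(x−u) + v̂(y−u) ) ) ) du ≥ a₁ t^{d/α} + c₁ t^{(d−2)/α} |x − y|². (This is the deterministic form of the two-point Laplace bound E[exp{−(t/2)(V_ω(x)+V_ω(y))}] ≤ exp{ −a₁ t^{d/α} − c₁ t^{(d−2)/α}|x−y|² } for the Poissonian potential.) -/

import Mathlib

open MeasureTheory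

/-- The volume of the unit ball in `ℝ^d`. -/
noncomputable def omegaD (d : ℕ) : ℝ :=
  (volume (Metric.ball (0 : EuclideanSpace ℝ (Fin d)) 1)).toReal

/-- The shape function `v̂(x) = min(|x|^{−α}, 1)`. -/
noncomputable def vhat (d : ℕ) (α : ℝ) (x : EuclideanSpace ℝ (Fin d)) : ℝ :=
  min (‖x‖ ^ (-α)) 1

/-- The constant `a₁ = ω_d Γ((α−d)/α)`. -/
noncomputable def a1 (d : ℕ) (α : ℝ) : ℝ :=
  omegaD d * Real.Gamma ((α - d) / α)

/-- The constant `C(d,α) = (α σ_d/(2d)) Γ((2α−d+2)/α)` with `σ_d = d ω_d`. -/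
noncomputable def Cda (d : ℕ) (α : ℝ) : ℝ :=
  (α * ((d : ℝ) * omegaD d) / (2 * d)) * Real.Gamma ((2 * α - d + 2) / α)

open Set Filter Topology

theorem integrableOn_rpow_mul_exp_neg_rpow_neg {α q : ℝ} (hα : 0 < α) (hq : q < -1) :
    IntegrableOn (fun y : ℝ => y ^ q * Real.exp (-y ^ (-α))) (Ioi 0) := by
  have h : 0 < -(q + 1) / α := by apply div_pos <;> linarith
  have := (integrableOn_Ioi_comp_rpow_iff' _ (neg_ne_zero.2 hα.ne')).2
    (Real.GammaIntegral_convergent h)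
  refine this.congr_fun (fun y (hy : 0 < y) => ?_) measurableSet_Ioi
  simp only [smul_eq_mul]
  rw [mul_left_comm, ← Real.rpow_mul hy.le, ← Real.rpow_add hy, mul_comm]
  congr 2
  field_simp
  ring

theorem integral_rpow_mul_exp_neg_rpow_neg {α q : ℝ} (hα : 0 < α) (hq : q < -1) :
    α * ∫ y in Ioi (0 : ℝ), y ^ q * Real.exp (-y ^ (-α)) = Real.Gamma (-(q + 1) / α) := by
  have h : 0 < -(q + 1) / α := by apply div_pos <;> linarith
  have := integral_comp_rpow_Ioi (fun x => Real.exp (-x) * x ^ (-(q + 1) / α - 1))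
    (neg_ne_zero.2 hα.ne')
  rw [Real.Gamma_eq_integral h, ← this, abs_neg, abs_of_pos hα, ← integral_const_mul]
  refine setIntegral_congr_fun measurableSet_Ioi fun y (hy : 0 < y) => ?_
  have e : y ^ q = y ^ (-α - 1) * (y ^ (-α)) ^ (-(q + 1) / α - 1) := by
    rw [← Real.rpow_mul hy.le, ← Real.rpow_add hy]
    congr 1
    field_simp
    ring
  simp only [smul_eq_mul, e]
  ring

theorem integrableOn_rpow_mul_one_sub_exp {α δ : ℝ} (hδ : 0 < δ) (hα : δ < α) :
    IntegrableOn (fun y : ℝ => y ^ (δ - 1) * (1 - Real.exp (-y ^ (-α)))) (Ioi 0) := by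
  have hm : Measurable (fun y : ℝ => y ^ (δ - 1) * (1 - Real.exp (-y ^ (-α)))) := by fun_prop
  rw [← Ioc_union_Ioi_eq_Ioi (zero_le_one' ℝ), integrableOn_union]
  constructor
  · have h : IntegrableOn (fun y : ℝ => y ^ (δ - 1)) (Ioc 0 1) := by
      rw [← intervalIntegrable_iff_integrableOn_Ioc_of_le zero_le_one]
      exact intervalIntegral.intervalIntegrable_rpow' (by linarith)
    refine h.mono' hm.aestronglyMeasurable ?_
    filter_upwards [ae_restrict_mem measurableSet_Ioc] with y hy
    have h1 : 0 ≤ y ^ (δ - 1) := Real.rpow_nonneg hy.1.le _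
    have h2 : 0 ≤ y ^ (-α) := Real.rpow_nonneg hy.1.le _
    have h3 : Real.exp (-y ^ (-α)) ≤ 1 := Real.exp_le_one_iff.2 (by linarith)
    rw [Real.norm_of_nonneg (mul_nonneg h1 (by linarith))]
    nlinarith [Real.exp_pos (-y ^ (-α))]
  · have h : IntegrableOn (fun y : ℝ => y ^ (δ - 1 - α)) (Ioi 1) :=
      integrableOn_Ioi_rpow_of_lt (by linarith) one_pos
    refine h.mono' hm.aestronglyMeasurable ?_
    filter_upwards [ae_restrict_mem measurableSet_Ioi] with y hy
    have hy : 1 < y := hy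
    have hy0 : 0 < y := by linarith
    have h1 : 0 ≤ y ^ (δ - 1) := Real.rpow_nonneg hy0.le _
    have h2 : 0 ≤ y ^ (-α) := Real.rpow_nonneg hy0.le _
    have h3 : Real.exp (-y ^ (-α)) ≤ 1 := Real.exp_le_one_iff.2 (by linarith)
    rw [Real.norm_of_nonneg (mul_nonneg h1 (by linarith)), sub_eq_add_neg (δ - 1),
      Real.rpow_add hy0]
    have := Real.add_one_le_exp (-y ^ (-α))
    gcongr
    linarith

theorem integral_rpow_mul_one_sub_exp {α δ : ℝ} (hδ : 0 < δ) (hα : δ < α) :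
    δ * ∫ y in Ioi (0 : ℝ), y ^ (δ - 1) * (1 - Real.exp (-y ^ (-α)))
      = Real.Gamma ((α - δ) / α) := by
  have hα0 : 0 < α := hδ.trans hα
  set v : ℝ → ℝ := fun y => 1 - Real.exp (-y ^ (-α)) with hv
  have hv0 : ∀ y, 0 < y → 0 ≤ v y := fun y hy => by
    have h2 : 0 ≤ y ^ (-α) := Real.rpow_nonneg hy.le _
    have h3 : Real.exp (-y ^ (-α)) ≤ 1 := Real.exp_le_one_iff.2 (by linarith)
    simp only [hv]; linarith
  have hv1 : ∀ y, v y ≤ 1 := fun y => by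
    have := Real.exp_pos (-y ^ (-α))
    simp only [hv]; linarith
  have hv2 : ∀ y, v y ≤ y ^ (-α) := fun y => by
    have := Real.add_one_le_exp (-y ^ (-α))
    simp only [hv]; linarith
  have key := integral_Ioi_mul_deriv_eq_deriv_mul (a := (0 : ℝ)) (a' := 0) (b' := 0)
    (u := fun y : ℝ => y ^ δ) (u' := fun y => δ * y ^ (δ - 1)) (v := v)
    (v' := fun y => -(α * (y ^ (-α - 1) * Real.exp (-y ^ (-α))))) ?_ ?_ ?_ ?_ ?_ ?_
  · have e1 : ∫ y in Ioi (0 : ℝ), y ^ δ * -(α * (y ^ (-α - 1) * Real.exp (-y ^ (-α))))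
        = -(α * ∫ y in Ioi (0 : ℝ), y ^ (δ - α - 1) * Real.exp (-y ^ (-α))) := by
      rw [← integral_const_mul, ← integral_neg]
      refine setIntegral_congr_fun measurableSet_Ioi fun y (hy : 0 < y) => ?_
      rw [show δ - α - 1 = δ + (-α - 1) by ring, Real.rpow_add hy]
      ring
    have e2 : ∫ y in Ioi (0 : ℝ), δ * y ^ (δ - 1) * v y
        = δ * ∫ y in Ioi (0 : ℝ), y ^ (δ - 1) * v y := by
      rw [← integral_const_mul]
      simp only [mul_assoc]
    rw [e1, e2, integral_rpow_mul_exp_neg_rpow_neg hα0 (by linarith)] at key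
    rw [show (α - δ) / α = -(δ - α - 1 + 1) / α by ring]
    linarith
  · exact fun y (hy : 0 < y) => Real.hasDerivAt_rpow_const (Or.inl hy.ne')
  · intro y (hy : 0 < y)
    have := ((Real.hasDerivAt_rpow_const (p := -α) (Or.inl hy.ne')).neg.exp).const_sub 1
    refine HasDerivAt.congr_deriv (f := v) this ?_
    simp only [Pi.neg_apply]
    ring
  · have := (integrableOn_rpow_mul_exp_neg_rpow_neg hα0 (q := δ - α - 1) (by linarith)).const_mul (-α)
    refine IntegrableOn.congr_fun this (fun y (hy : 0 < y) => ?_) measurableSet_Ioi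
    simp only [Pi.mul_apply]
    rw [show δ - α - 1 = δ + (-α - 1) by ring, Real.rpow_add hy]
    ring
  · have := (integrableOn_rpow_mul_one_sub_exp hδ hα).const_mul δ
    refine IntegrableOn.congr_fun this (fun y (hy : 0 < y) => ?_) measurableSet_Ioi
    simp only [Pi.mul_apply, hv]
    ring
  · have : Tendsto (fun y : ℝ => y ^ δ) (𝓝[>] 0) (𝓝 0) := by
      have := (Real.continuousAt_rpow_const 0 δ (Or.inr hδ.le)).tendsto
      rw [Real.zero_rpow hδ.ne'] at this
      exact this.mono_left nhdsWithin_le_nhds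
    refine squeeze_zero' ?_ ?_ this
    · filter_upwards [self_mem_nhdsWithin] with y hy
      exact mul_nonneg (Real.rpow_nonneg (le_of_lt hy) _) (hv0 y hy)
    · filter_upwards [self_mem_nhdsWithin] with y hy
      exact mul_le_of_le_one_right (Real.rpow_nonneg (le_of_lt hy) _) (hv1 y)
  · have := tendsto_rpow_neg_atTop (y := α - δ) (by linarith)
    refine squeeze_zero' ?_ ?_ this
    · filter_upwards [eventually_gt_atTop 0] with y hy
      exact mul_nonneg (Real.rpow_nonneg (le_of_lt hy) _) (hv0 y hy)
    · filter_upwards [eventually_gt_atTop 0] with y hy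
      rw [show -(α - δ) = δ + -α by ring, Real.rpow_add hy]
      exact mul_le_mul_of_nonneg_left (hv2 y) (Real.rpow_nonneg (le_of_lt hy) _)

/-- The truncated potential `min(|w|^{−α}, t)`. -/
noncomputable def truncPot (d : ℕ) (α t : ℝ) (w : EuclideanSpace ℝ (Fin d)) : ℝ :=
  min (‖w‖ ^ (-α)) t

section Radial

variable {d : ℕ} {α : ℝ}

theorem nontrivial_euclideanSpace_fin (hd : 1 ≤ d) : Nontrivial (EuclideanSpace ℝ (Fin d)) :=
  Module.nontrivial_of_finrank_pos (R := ℝ) (by rw [finrank_euclideanSpace_fin]; omega)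

theorem omegaD_nonneg : 0 ≤ omegaD d := ENNReal.toReal_nonneg

theorem omegaD_pos : 0 < omegaD d :=
  ENNReal.toReal_pos (Metric.measure_ball_pos volume _ one_pos).ne' measure_ball_lt_top.ne

theorem pow_sub_one_eq_rpow (hd : 1 ≤ d) {y : ℝ} : y ^ (d - 1) = y ^ ((d : ℝ) - 1) := by
  rw [← Real.rpow_natCast, Nat.cast_sub hd, Nat.cast_one]

theorem integrable_one_sub_exp_neg_norm_rpow (hd : 1 ≤ d) (hα : (d : ℝ) < α) :
    Integrable fun w : EuclideanSpace ℝ (Fin d) => 1 - Real.exp (-‖w‖ ^ (-α)) := by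
  have := nontrivial_euclideanSpace_fin hd
  have hd' : (0 : ℝ) < d := by exact_mod_cast hd
  rw [integrable_fun_norm_addHaar volume (f := fun y => 1 - Real.exp (-y ^ (-α)))]
  simpa only [finrank_euclideanSpace_fin, pow_sub_one_eq_rpow hd, smul_eq_mul] using
    integrableOn_rpow_mul_one_sub_exp hd' hα

theorem integral_one_sub_exp_neg_norm_rpow (hd : 1 ≤ d) (hα : (d : ℝ) < α) :
    ∫ w : EuclideanSpace ℝ (Fin d), (1 - Real.exp (-‖w‖ ^ (-α))) = a1 d α := by
  have := nontrivial_euclideanSpace_fin hd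
  have hd' : (0 : ℝ) < d := by exact_mod_cast hd
  rw [integral_fun_norm_addHaar volume (fun y => 1 - Real.exp (-y ^ (-α)))]
  simp only [finrank_euclideanSpace_fin, pow_sub_one_eq_rpow hd, smul_eq_mul, nsmul_eq_mul]
  rw [a1, ← integral_rpow_mul_one_sub_exp hd' hα, omegaD, Measure.real]
  ring

theorem lintegral_norm_rpow_mul_exp (hd : 1 ≤ d) (hα : (d : ℝ) < α) :
    ∫⁻ w : EuclideanSpace ℝ (Fin d),
      ENNReal.ofReal (‖w‖ ^ (-2 * α - 2) * Real.exp (-‖w‖ ^ (-α)))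
      = ENNReal.ofReal (d * omegaD d / α * Real.Gamma ((2 * α - d + 2) / α)) := by
  have := nontrivial_euclideanSpace_fin hd
  have hd' : (0 : ℝ) < d := by exact_mod_cast hd
  have hα0 : 0 < α := hd'.trans hα
  have e : EqOn (fun y : ℝ => y ^ ((d : ℝ) - 2 * α - 3) * Real.exp (-y ^ (-α)))
      (fun y => y ^ ((d : ℝ) - 1) * (y ^ (-2 * α - 2) * Real.exp (-y ^ (-α)))) (Ioi 0) := by
    intro y (hy : 0 < y)
    beta_reduce
    rw [← mul_assoc, ← Real.rpow_add hy]
    ring_nf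
  rw [← ofReal_integral_eq_lintegral_ofReal]
  · rw [integral_fun_norm_addHaar volume (fun y => y ^ (-2 * α - 2) * Real.exp (-y ^ (-α)))]
    simp only [finrank_euclideanSpace_fin, pow_sub_one_eq_rpow hd, smul_eq_mul, nsmul_eq_mul]
    rw [← setIntegral_congr_fun measurableSet_Ioi e,
      show (2 * α - d + 2) / α = -((d : ℝ) - 2 * α - 3 + 1) / α by ring,
      ← integral_rpow_mul_exp_neg_rpow_neg hα0 (by linarith), omegaD, Measure.real]
    congr 1
    field_simp
  · rw [integrable_fun_norm_addHaar volume
      (f := fun y => y ^ (-2 * α - 2) * Real.exp (-y ^ (-α)))]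
    simp only [finrank_euclideanSpace_fin, pow_sub_one_eq_rpow hd, smul_eq_mul]
    exact (integrableOn_rpow_mul_exp_neg_rpow_neg hα0 (by linarith)).congr_fun e measurableSet_Ioi
  · exact Eventually.of_forall fun w => by positivity

/-- Any two vectors of equal norm are exchanged by a linear isometry. -/
theorem exists_linearIsometryEquiv_apply_eq {v w : EuclideanSpace ℝ (Fin d)} (h : ‖v‖ = ‖w‖) :
    ∃ R : EuclideanSpace ℝ (Fin d) ≃ₗᵢ[ℝ] EuclideanSpace ℝ (Fin d), R v = w :=
  ⟨_, Submodule.reflection_sub h⟩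

theorem lintegral_radial_mul_inner_sq {ψ : ℝ → ℝ} (hψ : Measurable ψ) (hψ0 : ∀ r, 0 ≤ ψ r)
    {e : EuclideanSpace ℝ (Fin d)} (he : ‖e‖ = 1) :
    d * ∫⁻ w : EuclideanSpace ℝ (Fin d), ENNReal.ofReal (ψ ‖w‖ * inner ℝ w e ^ 2)
      = ∫⁻ w : EuclideanSpace ℝ (Fin d), ENNReal.ofReal (ψ ‖w‖ * ‖w‖ ^ 2) := by
  set b := EuclideanSpace.basisFun (Fin d) ℝ
  have h1 : ∀ i, ∫⁻ w : EuclideanSpace ℝ (Fin d), ENNReal.ofReal (ψ ‖w‖ * inner ℝ w (b i) ^ 2)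
      = ∫⁻ w : EuclideanSpace ℝ (Fin d), ENNReal.ofReal (ψ ‖w‖ * inner ℝ w e ^ 2) := by
    intro i
    obtain ⟨R, hR⟩ := exists_linearIsometryEquiv_apply_eq
      (show ‖e‖ = ‖b i‖ by rw [he, b.norm_eq_one])
    rw [← R.measurePreserving.lintegral_comp_emb R.toMeasurableEquiv.measurableEmbedding]
    simp only [← hR, LinearIsometryEquiv.norm_map, LinearIsometryEquiv.inner_map_map]
  have h2 : ∀ w : EuclideanSpace ℝ (Fin d), ENNReal.ofReal (ψ ‖w‖ * ‖w‖ ^ 2)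
      = ∑ i, ENNReal.ofReal (ψ ‖w‖ * inner ℝ w (b i) ^ 2) := by
    intro w
    rw [← ENNReal.ofReal_sum_of_nonneg fun i _ => mul_nonneg (hψ0 _) (sq_nonneg _),
      ← Finset.mul_sum, ← b.sum_sq_inner_left w]
  simp only [h2]
  rw [lintegral_finsetSum _ fun i _ => by fun_prop]
  simp [h1]

theorem hasDerivAt_exp_neg_norm_rpow {w e : EuclideanSpace ℝ (Fin d)} (hw : w ≠ 0) :
    HasDerivAt (fun s : ℝ => Real.exp (-(‖w + s • e‖ ^ (-α)) / 2))
      (Real.exp (-(‖w‖ ^ (-α)) / 2) * (α / 2 * ‖w‖ ^ (-α - 2) * inner ℝ w e)) 0 := by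
  have h0 : 0 < ‖w‖ := norm_pos_iff.2 hw
  have e1 : ∀ v : EuclideanSpace ℝ (Fin d), ‖v‖ ^ (-α) = (‖v‖ ^ 2) ^ (-α / 2) := fun v => by
    rw [← Real.rpow_natCast, ← Real.rpow_mul (norm_nonneg _)]
    congr 1
    push_cast
    ring
  have e2 : (‖w‖ ^ 2) ^ (-α / 2 - 1) = ‖w‖ ^ (-α - 2) := by
    rw [← Real.rpow_natCast, ← Real.rpow_mul (norm_nonneg _)]
    congr 1
    push_cast
    ring
  have h1 : HasDerivAt (fun s : ℝ => w + s • e) e 0 := by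
    simpa using ((hasDerivAt_id (0 : ℝ)).smul_const e).const_add w
  have h2 := h1.norm_sq
  have h3 := (h2.rpow_const (p := -α / 2) (Or.inl (by simpa using hw)))
  have h4 := (h3.neg.div_const 2).exp
  simp only [Pi.neg_apply, zero_smul, add_zero, e2, ← e1] at h4
  refine h4.congr_deriv ?_
  ring

theorem lintegral_sq_deriv (hd : 1 ≤ d) (hα : (d : ℝ) < α)
    {e : EuclideanSpace ℝ (Fin d)} (he : ‖e‖ = 1) :
    ∫⁻ w : EuclideanSpace ℝ (Fin d), ENNReal.ofReal
      ((Real.exp (-(‖w‖ ^ (-α)) / 2) * (α / 2 * ‖w‖ ^ (-α - 2) * inner ℝ w e)) ^ 2)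
      = ENNReal.ofReal (Cda d α / 2) := by
  have hd' : (0 : ℝ) < d := by exact_mod_cast hd
  have hα0 : 0 < α := hd'.trans hα
  have h := lintegral_radial_mul_inner_sq (d := d)
    (ψ := fun r => (Real.exp (-(r ^ (-α)) / 2) * (α / 2 * r ^ (-α - 2))) ^ 2)
    (by fun_prop) (fun r => sq_nonneg _) he
  have h2 : ∀ w : EuclideanSpace ℝ (Fin d),
      (Real.exp (-(‖w‖ ^ (-α)) / 2) * (α / 2 * ‖w‖ ^ (-α - 2))) ^ 2 * ‖w‖ ^ 2
        = (α / 2) ^ 2 * (‖w‖ ^ (-2 * α - 2) * Real.exp (-‖w‖ ^ (-α))) := by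
    intro w
    rcases eq_or_ne w 0 with rfl | hw
    · rw [norm_zero, Real.zero_rpow (show -2 * α - 2 ≠ 0 by linarith)]
      simp
    · have h0 : 0 < ‖w‖ := norm_pos_iff.2 hw
      have e1 : ‖w‖ ^ (-2 * α - 2) = (‖w‖ ^ (-α - 2)) ^ 2 * ‖w‖ ^ 2 := by
        rw [← Real.rpow_natCast, ← Real.rpow_natCast, ← Real.rpow_mul h0.le, ← Real.rpow_add h0]
        congr 1
        push_cast
        ring
      have e2 : Real.exp (-‖w‖ ^ (-α)) = Real.exp (-(‖w‖ ^ (-α)) / 2) ^ 2 := by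
        rw [← Real.exp_nat_mul]
        congr 1
        push_cast
        ring
      rw [e1, e2]
      ring
  simp only [h2, ENNReal.ofReal_mul (sq_nonneg (α / 2))] at h
  rw [lintegral_const_mul _ (by fun_prop), lintegral_norm_rpow_mul_exp hd hα,
    ← ENNReal.ofReal_mul (sq_nonneg _)] at h
  have h3 : ENNReal.ofReal ((α / 2) ^ 2 *
      (d * omegaD d / α * Real.Gamma ((2 * α - d + 2) / α)))
      = d * ENNReal.ofReal (Cda d α / 2) := by
    rw [← ENNReal.ofReal_natCast, ← ENNReal.ofReal_mul hd'.le, Cda]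
    congr 1
    field_simp
  rw [h3] at h
  have h4 := (ENNReal.mul_right_inj (by simpa using hd'.ne') (ENNReal.natCast_ne_top d)).1 h
  rw [← h4]
  refine lintegral_congr fun w => ?_
  ring_nf

/-- The function `exp(−min(|w|^{−α}, t)/2)`. -/
noncomputable def halfExp (d : ℕ) (α t : ℝ) (w : EuclideanSpace ℝ (Fin d)) : ℝ :=
  Real.exp (-truncPot d α t w / 2)

theorem measurable_halfExp (t : ℝ) : Measurable (halfExp d α t) := by
  unfold halfExp truncPot
  fun_prop

theorem tendsto_halfExp_slope_sq {w e : EuclideanSpace ℝ (Fin d)} (hw : w ≠ 0) :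
    Tendsto (fun p : ℝ × ℝ => ((halfExp d α p.1 (w + p.2 • e) - halfExp d α p.1 w) / p.2) ^ 2)
      (atTop ×ˢ 𝓝[>] 0)
      (𝓝 ((Real.exp (-(‖w‖ ^ (-α)) / 2) * (α / 2 * ‖w‖ ^ (-α - 2) * inner ℝ w e)) ^ 2)) := by
  have h1 := hasDerivAt_iff_tendsto_slope_zero.1 (hasDerivAt_exp_neg_norm_rpow (α := α) (e := e) hw)
  have h2 : Tendsto (Prod.snd : ℝ × ℝ → ℝ) (atTop ×ˢ 𝓝[>] 0) (𝓝[≠] 0) :=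
    tendsto_snd.mono_right (nhdsWithin_mono _ fun x hx => (ne_of_gt hx))
  refine ((h1.comp h2).pow 2).congr' ?_
  have hc : Tendsto (fun s : ℝ => ‖w + s • e‖ ^ (-α)) (𝓝[>] 0) (𝓝 (‖w‖ ^ (-α))) := by
    have : ContinuousAt (fun s : ℝ => ‖w + s • e‖ ^ (-α)) 0 := by
      refine ContinuousAt.rpow_const (by fun_prop) (Or.inl ?_)
      simpa using hw
    have := this.tendsto
    simp only [zero_smul, add_zero] at this
    exact this.mono_left nhdsWithin_le_nhds
  have h3 := (eventually_ge_atTop (‖w‖ ^ (-α) + 1)).prod_mk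
    (hc.eventually (eventually_lt_nhds (lt_add_one (‖w‖ ^ (-α)))))
  filter_upwards [h3] with p hp
  simp only [Function.comp_apply, halfExp, truncPot, zero_add, zero_smul, add_zero, smul_eq_mul]
  rw [min_eq_left (by linarith : ‖w‖ ^ (-α) ≤ p.1),
    min_eq_left (by linarith [hp.1, hp.2] : ‖w + p.2 • e‖ ^ (-α) ≤ p.1)]
  ring

theorem eventually_lt_lintegral_slope_sq (hd : 1 ≤ d) (hα : (d : ℝ) < α)
    {e : EuclideanSpace ℝ (Fin d)} (he : ‖e‖ = 1) {c : ℝ} (hc0 : 0 ≤ c) (hc : c < Cda d α / 2) :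
    ∀ᶠ p : ℝ × ℝ in atTop ×ˢ 𝓝[>] 0, ENNReal.ofReal c <
      ∫⁻ w, ENNReal.ofReal (((halfExp d α p.1 (w + p.2 • e) - halfExp d α p.1 w) / p.2) ^ 2) := by
  have := nontrivial_euclideanSpace_fin hd
  refine eventually_lt_of_lt_liminf (lt_of_lt_of_le ?_ (lintegral_liminf_le' fun p => ?_))
  · calc ENNReal.ofReal c < ENNReal.ofReal (Cda d α / 2) :=
          (ENNReal.ofReal_lt_ofReal_iff (by linarith)).2 hc
      _ = _ := by
        rw [← lintegral_sq_deriv hd hα he]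
        refine lintegral_congr_ae ?_
        filter_upwards [compl_mem_ae_iff.2 (measure_singleton (0 : EuclideanSpace ℝ (Fin d)))]
          with w hw
        exact (ENNReal.tendsto_ofReal (tendsto_halfExp_slope_sq hw)).liminf_eq.symm
  · have := measurable_halfExp (d := d) (α := α) p.1
    fun_prop

/-- The energy `∫ (g(w+η) − g(w))² dw` of a radial `g` depends on `η` only through its norm. -/
theorem lintegral_halfExp_diff_sq_eq {t : ℝ} {η ζ : EuclideanSpace ℝ (Fin d)} (h : ‖η‖ = ‖ζ‖) :
    ∫⁻ w, ENNReal.ofReal ((halfExp d α t (w + η) - halfExp d α t w) ^ 2)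
      = ∫⁻ w, ENNReal.ofReal ((halfExp d α t (w + ζ) - halfExp d α t w) ^ 2) := by
  obtain ⟨R, rfl⟩ := exists_linearIsometryEquiv_apply_eq h
  have hR : ∀ w, halfExp d α t (R w) = halfExp d α t w := fun w => by
    simp only [halfExp, truncPot, LinearIsometryEquiv.norm_map]
  rw [← R.measurePreserving.lintegral_comp_emb R.toMeasurableEquiv.measurableEmbedding
    (fun w => ENNReal.ofReal ((halfExp d α t (w + R η) - halfExp d α t w) ^ 2))]
  simp only [← map_add, hR]

theorem truncPot_nonneg {t : ℝ} (ht : 0 ≤ t) (w : EuclideanSpace ℝ (Fin d)) :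
    0 ≤ truncPot d α t w := le_min (by positivity) ht

theorem halfExp_pos (t : ℝ) (w : EuclideanSpace ℝ (Fin d)) : 0 < halfExp d α t w :=
  Real.exp_pos _

theorem halfExp_le_one {t : ℝ} (ht : 0 ≤ t) (w : EuclideanSpace ℝ (Fin d)) :
    halfExp d α t w ≤ 1 :=
  Real.exp_le_one_iff.2 (by linarith [truncPot_nonneg (α := α) ht w])

theorem halfExp_sq (t : ℝ) (w : EuclideanSpace ℝ (Fin d)) :
    halfExp d α t w ^ 2 = Real.exp (-truncPot d α t w) := by
  rw [halfExp, ← Real.exp_nat_mul]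
  congr 1
  push_cast
  ring

theorem integrable_one_sub_halfExp_sq (hd : 1 ≤ d) (hα : (d : ℝ) < α) {t : ℝ} (ht : 0 ≤ t) :
    Integrable fun w => 1 - halfExp d α t w ^ 2 := by
  have hm := measurable_halfExp (d := d) (α := α) t
  refine (integrable_one_sub_exp_neg_norm_rpow hd hα).mono' (by fun_prop) ?_
  refine Eventually.of_forall fun w => ?_
  have h1 := halfExp_le_one (α := α) ht w
  have h0 := halfExp_pos (α := α) t w
  rw [Real.norm_of_nonneg (by nlinarith), halfExp_sq]
  have : truncPot d α t w ≤ ‖w‖ ^ (-α) := min_le_left _ _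
  gcongr

theorem integrable_halfExp_diff_sq (hd : 1 ≤ d) (hα : (d : ℝ) < α) {t : ℝ} (ht : 0 ≤ t)
    (η : EuclideanSpace ℝ (Fin d)) :
    Integrable fun w => (halfExp d α t (w + η) - halfExp d α t w) ^ 2 := by
  have hm := measurable_halfExp (d := d) (α := α) t
  have hi := integrable_one_sub_halfExp_sq hd hα ht
  refine ((hi.comp_add_right η).add hi).mono' (by fun_prop) ?_
  refine Eventually.of_forall fun w => ?_
  have h1 := halfExp_le_one (α := α) ht w
  have h0 := halfExp_pos (α := α) t w
  have h1' := halfExp_le_one (α := α) ht (w + η)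
  have h0' := halfExp_pos (α := α) t (w + η)
  rw [Real.norm_of_nonneg (sq_nonneg _), Pi.add_apply]
  nlinarith [mul_nonneg h0.le (sub_nonneg.2 h1), mul_nonneg h0'.le (sub_nonneg.2 h1'),
    mul_nonneg (sub_nonneg.2 h1) (sub_nonneg.2 h1'), mul_pos h0 h0']

/-- Uniform lower bound on the energy for small shifts and high truncation levels. -/
theorem eventually_le_integral_halfExp_diff_sq (hd : 1 ≤ d) (hα : (d : ℝ) < α)
    {c : ℝ} (hc0 : 0 ≤ c) (hc : c < Cda d α / 2) :
    ∃ T s₀ : ℝ, 0 < s₀ ∧ ∀ t ≥ T, ∀ η : EuclideanSpace ℝ (Fin d), 0 < ‖η‖ → ‖η‖ < s₀ →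
      c * ‖η‖ ^ 2 ≤ ∫ w, (halfExp d α t (w + η) - halfExp d α t w) ^ 2 := by
  have := nontrivial_euclideanSpace_fin hd
  obtain ⟨e, he⟩ := exists_norm_eq (EuclideanSpace ℝ (Fin d)) zero_le_one
  have h := eventually_lt_lintegral_slope_sq hd hα he hc0 hc
  obtain ⟨p, hp, q, hq, hpq⟩ := eventually_prod_iff.1 h
  obtain ⟨T, hT⟩ := eventually_atTop.1 hp
  obtain ⟨s₀, hs₀, hs⟩ := (mem_nhdsGT_iff_exists_Ioo_subset).1 hq
  refine ⟨max T 0, s₀, hs₀, fun t ht η h0 h1 => ?_⟩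
  have ht0 : 0 ≤ t := (le_max_right _ _).trans ht
  have key := hpq (hT t ((le_max_left _ _).trans ht)) (hs ⟨h0, h1⟩)
  simp only [div_pow, div_eq_inv_mul (_ ^ 2) (_ ^ 2)] at key
  have hm := measurable_halfExp (d := d) (α := α) t
  simp only [ENNReal.ofReal_mul (inv_nonneg.2 (sq_nonneg ‖η‖))] at key
  rw [lintegral_const_mul _ (by fun_prop), lintegral_halfExp_diff_sq_eq (ζ := η)
    (by rw [norm_smul, he, norm_norm, mul_one]), ← ofReal_integral_eq_lintegral_ofReal
    (integrable_halfExp_diff_sq hd hα ht0 η) (Eventually.of_forall fun w => sq_nonneg _),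
    ← ENNReal.ofReal_mul (inv_nonneg.2 (sq_nonneg ‖η‖)), ENNReal.ofReal_lt_ofReal_iff_of_nonneg hc0,
    ← div_eq_inv_mul, lt_div_iff₀ (by positivity)] at key
  exact key.le

theorem a1_sub_le_integral (hd : 1 ≤ d) (hα : (d : ℝ) < α) {t : ℝ} (ht : 1 ≤ t) :
    a1 d α - omegaD d * Real.exp (-t) ≤ ∫ w, (1 - halfExp d α t w ^ 2) := by
  have hα0 : 0 < α := lt_of_le_of_lt (Nat.cast_nonneg d) hα
  have hb : Integrable ((Metric.ball (0 : EuclideanSpace ℝ (Fin d)) 1).indicator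
      fun _ => Real.exp (-t)) :=
    (integrable_indicator_iff measurableSet_ball).2 (integrableOn_const measure_ball_lt_top.ne)
  have e1 : omegaD d * Real.exp (-t) = ∫ w, (Metric.ball (0 : EuclideanSpace ℝ (Fin d)) 1).indicator
      (fun _ => Real.exp (-t)) w := by
    rw [integral_indicator measurableSet_ball, setIntegral_const, smul_eq_mul, omegaD, Measure.real]
  rw [← integral_one_sub_exp_neg_norm_rpow hd hα, e1,
    ← integral_sub (integrable_one_sub_exp_neg_norm_rpow hd hα) hb]
  refine integral_mono ((integrable_one_sub_exp_neg_norm_rpow hd hα).sub hb)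
    (integrable_one_sub_halfExp_sq hd hα (by linarith)) fun w => ?_
  simp only [halfExp_sq, truncPot]
  rcases le_or_gt (‖w‖ ^ (-α)) t with h | h
  · rw [min_eq_left h]
    have : 0 ≤ (Metric.ball (0 : EuclideanSpace ℝ (Fin d)) 1).indicator
      (fun _ => Real.exp (-t)) w := indicator_nonneg (fun _ _ => (Real.exp_pos _).le) _
    linarith
  · rw [min_eq_right h.le, indicator_of_mem]
    · linarith [Real.exp_pos (-‖w‖ ^ (-α))]
    · rw [mem_ball_zero_iff]
      by_contra! hw
      linarith [Real.rpow_le_one_of_one_le_of_nonpos hw (neg_nonpos.2 hα0.le)]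

theorem Cda_pos (hd : 1 ≤ d) (hα : (d : ℝ) < α) : 0 < Cda d α := by
  have hd' : (0 : ℝ) < d := by exact_mod_cast hd
  have hα0 : 0 < α := hd'.trans hα
  have h1 := omegaD_pos (d := d)
  have h2 : 0 < Real.Gamma ((2 * α - d + 2) / α) :=
    Real.Gamma_pos_of_pos (div_pos (by linarith) hα0)
  unfold Cda
  positivity

theorem mul_vhat_smul (hα : 0 < α) {t : ℝ} (ht : 0 < t) (w : EuclideanSpace ℝ (Fin d)) :
    t * vhat d α (t ^ (1 / α) • w) = truncPot d α t w := by
  have hL : 0 < t ^ (1 / α) := Real.rpow_pos_of_pos ht _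
  rw [vhat, truncPot, norm_smul, Real.norm_of_nonneg hL.le,
    Real.mul_rpow hL.le (norm_nonneg _), ← Real.rpow_mul ht.le,
    show 1 / α * -α = -1 by field_simp, Real.rpow_neg_one, mul_min_of_nonneg _ _ ht.le,
    mul_inv_cancel_left₀ ht.ne', mul_one]

/-- Rescaling by `t^{1/α}` and polarization of the two-point integral. -/
theorem integral_two_point_eq (hd : 1 ≤ d) (hα : (d : ℝ) < α) {t : ℝ} (ht : 0 < t)
    {x y η : EuclideanSpace ℝ (Fin d)} (hη : x - y = t ^ (1 / α) • η) :
    ∫ u : EuclideanSpace ℝ (Fin d),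
        (1 - Real.exp (-(t / 2) * (vhat d α (x - u) + vhat d α (y - u))))
      = t ^ ((d : ℝ) / α) * ((∫ w, (1 - halfExp d α t w ^ 2))
        + 1 / 2 * ∫ w, (halfExp d α t (w + η) - halfExp d α t w) ^ 2) := by
  have hα0 : 0 < α := lt_of_le_of_lt (Nat.cast_nonneg d) hα
  have hL : 0 < t ^ (1 / α) := Real.rpow_pos_of_pos ht _
  set F : EuclideanSpace ℝ (Fin d) → ℝ := fun u =>
    1 - Real.exp (-(t / 2) * (vhat d α (x - u) + vhat d α (y - u))) with hF
  have hscale : ∫ u, F u = t ^ ((d : ℝ) / α) * ∫ w, F (y - t ^ (1 / α) • w) := by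
    rw [Measure.integral_comp_smul_of_nonneg volume (fun u => F (y - u)) _ (hR := hL.le),
      integral_sub_left_eq_self F volume y, finrank_euclideanSpace_fin, ← Real.rpow_natCast,
      ← Real.rpow_mul ht.le, smul_eq_mul, one_div_mul_eq_div,
      mul_inv_cancel_left₀ (Real.rpow_pos_of_pos ht _).ne']
  have hpt : ∀ w, F (y - t ^ (1 / α) • w) = 1 / 2 * (1 - halfExp d α t (w + η) ^ 2)
      + 1 / 2 * (1 - halfExp d α t w ^ 2)
      + 1 / 2 * (halfExp d α t (w + η) - halfExp d α t w) ^ 2 := by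
    intro w
    have e1 : x - (y - t ^ (1 / α) • w) = t ^ (1 / α) • (w + η) := by
      rw [smul_add, ← hη]
      abel
    have e2 : Real.exp (-(t / 2) * (vhat d α (t ^ (1 / α) • (w + η)) + vhat d α (t ^ (1 / α) • w)))
        = halfExp d α t (w + η) * halfExp d α t w := by
      rw [halfExp, halfExp, ← Real.exp_add, ← mul_vhat_smul hα0 ht, ← mul_vhat_smul hα0 ht]
      congr 1
      ring
    simp only [hF, e1, sub_sub_cancel, e2]
    ring
  have hi := integrable_one_sub_halfExp_sq hd hα ht.le
  have hi' := hi.comp_add_right η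
  have hj := integrable_halfExp_diff_sq hd hα ht.le η
  rw [hscale, integral_congr_ae (Eventually.of_forall hpt),
    integral_add (by exact (hi'.const_mul _).add (hi.const_mul _)) (hj.const_mul _),
    integral_add (hi'.const_mul _) (hi.const_mul _), integral_const_mul, integral_const_mul,
    integral_const_mul, integral_add_right_eq_self (fun w => 1 - halfExp d α t w ^ 2)]
  ring

end Radial

/-- with `c₁ = C(d,α)/5`, for large `t` and all `x, y` with
`1 ≤ |x−y| < t^{1/α−ε}`,
`∫ (1 − exp(−(t/2)(v̂(x−u)+v̂(y−u)))) du ≥ a₁ t^{d/α} + c₁ t^{(d−2)/α}|x−y|²`. -/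
theorem stmt_7 (d : ℕ) (hd : 1 ≤ d) (α : ℝ) (hα₁ : (d : ℝ) < α)
    (hα₂ : α < d + 2) (ε : ℝ) (hε : ε ∈ Set.Ioo 0 (1 / α)) :
    ∃ T : ℝ, 0 < T ∧ ∀ t : ℝ, T ≤ t →
      ∀ x y : EuclideanSpace ℝ (Fin d),
        1 ≤ ‖x - y‖ → ‖x - y‖ < t ^ (1 / α - ε) →
        a1 d α * t ^ ((d : ℝ) / α)
            + (Cda d α / 5) * t ^ (((d : ℝ) - 2) / α) * ‖x - y‖ ^ 2
          ≤ ∫ u : EuclideanSpace ℝ (Fin d),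
              (1 - Real.exp (-(t / 2) * (vhat d α (x - u) + vhat d α (y - u)))) := by
  have hd' : (0 : ℝ) < d := by exact_mod_cast hd
  have hα0 : 0 < α := hd'.trans hα₁
  have hC := Cda_pos hd hα₁
  obtain ⟨T₁, s₀, hs₀, hmain⟩ := eventually_le_integral_halfExp_diff_sq hd hα₁
    (c := 9 * Cda d α / 20) (by positivity) (by linarith)
  have hsmall : ∀ᶠ t : ℝ in atTop, t ^ (-ε) < s₀ :=
    (tendsto_rpow_neg_atTop hε.1).eventually (eventually_lt_nhds hs₀)
  have herr : ∀ᶠ t : ℝ in atTop, omegaD d * (t ^ (2 / α) * Real.exp (-1 * t)) < Cda d α / 40 := by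
    have := (tendsto_rpow_mul_exp_neg_mul_atTop_nhds_zero (2 / α) 1 one_pos).const_mul (omegaD d)
    rw [mul_zero] at this
    exact this.eventually (eventually_lt_nhds (by positivity))
  obtain ⟨T, hT⟩ := eventually_atTop.1 (hsmall.and (herr.and (eventually_ge_atTop T₁)))
  refine ⟨max T 1, by positivity, fun t ht x y hxy1 hxy2 => ?_⟩
  obtain ⟨h1, h2, h3⟩ := hT t ((le_max_left _ _).trans ht)
  have ht1 : 1 ≤ t := (le_max_right _ _).trans ht
  have ht0 : 0 < t := by linarith
  have hL : 0 < t ^ (1 / α) := Real.rpow_pos_of_pos ht0 _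
  set η := (t ^ (1 / α))⁻¹ • (x - y) with hη
  have hxη : x - y = t ^ (1 / α) • η := (smul_inv_smul₀ hL.ne' _).symm
  have hnorm : ‖x - y‖ = t ^ (1 / α) * ‖η‖ := by
    rw [hxη, norm_smul, Real.norm_of_nonneg hL.le]
  have hη0 : 0 < ‖η‖ := by
    by_contra! h
    nlinarith
  have hηs : ‖η‖ < s₀ := by
    refine lt_trans ?_ h1
    rw [hnorm, sub_eq_add_neg, Real.rpow_add ht0] at hxy2
    exact lt_of_mul_lt_mul_left hxy2 hL.le
  have hL2 : (t ^ (1 / α)) ^ 2 = t ^ (2 / α) := by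
    rw [← Real.rpow_natCast, ← Real.rpow_mul ht0.le]
    congr 1
    push_cast
    ring
  have hpow : t ^ (((d : ℝ) - 2) / α) * ‖x - y‖ ^ 2 = t ^ ((d : ℝ) / α) * ‖η‖ ^ 2 := by
    rw [hnorm, mul_pow, hL2, ← mul_assoc, ← Real.rpow_add ht0]
    ring_nf
  have hexp : omegaD d * Real.exp (-t) ≤ Cda d α / 40 * ‖η‖ ^ 2 := by
    have h4 : 1 ≤ t ^ (2 / α) * ‖η‖ ^ 2 := by
      rw [← hL2, ← mul_pow, ← hnorm]
      exact one_le_pow₀ hxy1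
    rw [neg_one_mul] at h2
    calc omegaD d * Real.exp (-t)
        ≤ omegaD d * Real.exp (-t) * (t ^ (2 / α) * ‖η‖ ^ 2) :=
          le_mul_of_one_le_right (mul_nonneg omegaD_nonneg (Real.exp_pos _).le) h4
      _ = omegaD d * (t ^ (2 / α) * Real.exp (-t)) * ‖η‖ ^ 2 := by ring
      _ ≤ _ := mul_le_mul_of_nonneg_right h2.le (sq_nonneg _)
  rw [integral_two_point_eq hd hα₁ ht0 hxη, mul_assoc, hpow, mul_left_comm, mul_comm (a1 d α),
    ← mul_add]
  refine mul_le_mul_of_nonneg_left ?_ (Real.rpow_nonneg ht0.le _)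
  linarith [hmain t h3 η hη0 hηs, a1_sub_le_integral hd hα₁ ht1]
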